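/- arXiv:2207.05190 — 2 statements merged into one kernel-verified Lean document; each statement's English description precedes it below -/
import Mathlib

section
/- (Coverage Property.) Let π, α ∈ (0,1). Let θ_1,…,θ_n be i.i.d. random variables with P(θ_i = ϑ_k) = γ*_k for a probability vector γ* on support points ϑ_1 < … < ϑ_K, and let X_i = θ_i + Z_i with Z_1,…,Z_n i.i.d. N(0,1) independent of (θ_1,…,θ_n). Let B_{1−π} be the (1−π)-quantile of B(U) for U the order statistics of n i.i.d. Uniform(0,1) variables, and let Γ_{1−π} = { γ : B(F_{ϑ,γ}(X_(1)),…,F_{ϑ,γ}(X_(n))) ≤ B_{1−π} }, a random subset of the probability simplex. For a probability vector γ and index i, define the posterior weights p_j(γ, X_i) = γ_j·φ(X_i−ϑ_j) / Σ_{k=1}^K γ_k·φ(X_i−ϑ_k), the lower endpoint θ^lower_{α/2}(γ, X_i) = max{ ϑ_ℓ : Σ_{k=1}^ℓ p_k(γ,X_i) ≤ α/2 } (taken as ϑ_1 if no such ℓ exists), and the upper endpoint θ^upper_{α/2}(γ, X_i) = min{ ϑ_r : Σ_{k=r}^K p_k(γ,X_i) ≤ α/2 } (taken as ϑ_K if no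 such r exists). Define the interval C_i(1−π, 1−α) = [ inf_{γ ∈ Γ_{1−π}} θ^lower_{α/2}(γ, X_i), sup_{γ ∈ Γ_{1−π}} θ^upper_{α/2}(γ, X_i) ]. Then for each i, P( θ_i ∈ C_i(1−π, 1−α) ) ≥ (1−π)(1−α). -/
open MeasureTheory ProbabilityTheory

noncomputable section

/-- The nondecreasing (sorted) rearrangement of a vector: its order statistics. -/
def orderStat {n : ℕ} (x : Fin n → ℝ) : Fin n → ℝ := x ∘ Tuple.sort x

/-- `B(u) = -∑ᵢ (aᵢ log uᵢ + bᵢ log (1 - uᵢ))`. -/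
def Bfun {n : ℕ} (a b : Fin n → ℝ) (u : Fin n → ℝ) : ℝ :=
  -∑ i, (a i * Real.log (u i) + b i * Real.log (1 - u i))

/-- The standard normal cdf `Φ`. -/
def stdNormCDF (t : ℝ) : ℝ := ((gaussianReal 0 1) (Set.Iic t)).toReal

/-- The standard normal density `φ`. -/
def stdNormPDF (t : ℝ) : ℝ := gaussianPDFReal 0 1 t

/-- The mixture cdf `F_{ϑ,γ}(x) = ∑ₖ γₖ Φ(x - ϑₖ)`. -/
def mixCDF {K : ℕ} (ϑ γ : Fin K → ℝ) (x : ℝ) : ℝ := ∑ k, γ k * stdNormCDF (x - ϑ k)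

/-- The law of `B(U)` for `U = (U₍₁₎,…,U₍ₙ₎)` the order statistics of `n` i.i.d.
`Uniform(0,1)` random variables. -/
def lawBU (n : ℕ) (a b : Fin n → ℝ) : Measure ℝ :=
  Measure.map (fun u : Fin n → ℝ => Bfun a b (orderStat u))
    (Measure.pi fun _ : Fin n => volume.restrict (Set.Ioc (0:ℝ) 1))

/-- The `(1-π)`-quantile `B_{1-π}` of `B(U)`. -/
def quantileBU (n : ℕ) (a b : Fin n → ℝ) (π : ℝ) : ℝ :=
  sInf {t : ℝ | 1 - π ≤ ((lawBU n a b) (Set.Iic t)).toReal}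

/-- Posterior weights `p_j(γ, x) = γⱼ φ(x - ϑⱼ) / ∑ₖ γₖ φ(x - ϑₖ)`. -/
def postW {K : ℕ} (ϑ γ : Fin K → ℝ) (x : ℝ) (j : Fin K) : ℝ :=
  γ j * stdNormPDF (x - ϑ j) / ∑ k, γ k * stdNormPDF (x - ϑ k)

/-- The lower endpoint `θ^lower_{α/2}(γ, x) = max{ϑ_ℓ : ∑_{k ≤ ℓ} p_k(γ,x) ≤ α/2}`,
taken as `ϑ_1` if no such `ℓ` exists. -/
def lowerEP {K : ℕ} [NeZero K] (ϑ γ : Fin K → ℝ) (α x : ℝ) : ℝ :=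
  let L := Finset.univ.filter fun ℓ : Fin K => ∑ k ∈ Finset.Iic ℓ, postW ϑ γ x k ≤ α / 2
  if h : L.Nonempty then ϑ (L.max' h) else ϑ 0

/-- The upper endpoint `θ^upper_{α/2}(γ, x) = min{ϑ_r : ∑_{k ≥ r} p_k(γ,x) ≤ α/2}`,
taken as `ϑ_K` if no such `r` exists. -/
def upperEP {K : ℕ} [NeZero K] (ϑ γ : Fin K → ℝ) (α x : ℝ) : ℝ :=
  let R := Finset.univ.filter fun r : Fin K => ∑ k ∈ Finset.Ici r, postW ϑ γ x k ≤ α / 2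
  if h : R.Nonempty then ϑ (R.min' h) else ϑ ⟨K - 1, Nat.sub_lt (NeZero.pos K) one_pos⟩

/-- The plausibility region `Γ_{1-π}` (evaluated at the data vector `x` and cutoff `q`):
all probability vectors `γ` with `B(F_{ϑ,γ}(x₍₁₎),…,F_{ϑ,γ}(x₍ₙ₎)) ≤ q`. -/
def GammaRegion {n K : ℕ} (a b : Fin n → ℝ) (ϑ : Fin K → ℝ) (q : ℝ) (x : Fin n → ℝ) :
    Set (Fin K → ℝ) :=
  {γ | (∀ k, 0 ≤ γ k) ∧ (∑ k, γ k = 1) ∧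
    Bfun a b (fun l => mixCDF ϑ γ (orderStat x l)) ≤ q}


theorem measurable_tupleSort (n : ℕ) :
    Measurable[_, ⊤] (Tuple.sort : (Fin n → ℝ) → Equiv.Perm (Fin n)) := by
  let _ : MeasurableSpace (Equiv.Perm (Fin n)) := ⊤
  refine measurable_to_countable' fun σ => ?_
  have hset : (Tuple.sort : (Fin n → ℝ) → Equiv.Perm (Fin n)) ⁻¹' {σ} =
      (⋂ i, ⋂ j, ⋂ _ : i ≤ j, {x | x (σ i) ≤ x (σ j)}) ∩
        ⋂ i, ⋂ j, ⋂ _ : i < j, {x | x (σ i) = x (σ j) → σ i < σ j} := by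
    ext x
    rw [Set.mem_preimage, Set.mem_singleton_iff, eq_comm, Tuple.eq_sort_iff]
    simp [Monotone]
  rw [hset]
  refine .inter (.iInter fun i => .iInter fun j => ?_) (.iInter fun i => .iInter fun j => ?_)
  · exact .iInter fun _ => measurableSet_le (measurable_pi_apply _) (measurable_pi_apply _)
  · refine .iInter fun _ => ?_
    by_cases h : σ i < σ j
    · simp [h]
    · simp only [h, imp_false]
      exact (measurableSet_eq_fun (measurable_pi_apply (X := fun _ => ℝ) (σ i))
          (measurable_pi_apply (X := fun _ => ℝ) (σ j))).compl

theorem measurable_orderStat (n : ℕ) : Measurable (orderStat : (Fin n → ℝ) → Fin n → ℝ) := by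
  let _ : MeasurableSpace (Equiv.Perm (Fin n)) := ⊤
  have h : Measurable fun p : (Fin n → ℝ) × Equiv.Perm (Fin n) => p.1 ∘ p.2 :=
    measurable_from_prod_countable_left fun σ =>
      measurable_pi_lambda _ fun i => measurable_pi_apply (σ i)
  exact h.comp (measurable_id.prodMk (measurable_tupleSort n))

theorem orderStat_comp_of_monotone {n : ℕ} {F : ℝ → ℝ} (hF : Monotone F) (x : Fin n → ℝ) :
    orderStat (fun i => F (x i)) = fun l => F (orderStat x l) :=
  (Tuple.comp_sort_eq_comp_iff_monotone.mpr
    (hF.comp (Tuple.monotone_sort x) : Monotone ((F ∘ x) ∘ Tuple.sort x))).symm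

theorem measurable_Bfun {n : ℕ} (a b : Fin n → ℝ) : Measurable (Bfun a b) := by
  unfold Bfun
  fun_prop

theorem le_measure_Iic_quantileBU (n : ℕ) (a b : Fin n → ℝ) {π : ℝ} (hπ : π ∈ Set.Ioo (0:ℝ) 1) :
    1 - π ≤ (lawBU n a b).real (Set.Iic (quantileBU n a b π)) := by
  have : IsProbabilityMeasure (volume.restrict (Set.Ioc (0:ℝ) 1)) := ⟨by simp⟩
  have : IsProbabilityMeasure (lawBU n a b) :=
    Measure.isProbabilityMeasure_map
      ((measurable_Bfun a b).comp (measurable_orderStat n)).aemeasurable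
  set S := {t : ℝ | 1 - π ≤ ((lawBU n a b) (Set.Iic t)).toReal} with hS
  have hS' : S = {t | 1 - π ≤ cdf (lawBU n a b) t} := by
    simp [hS, cdf_eq_real, Measure.real]
  have hne : S.Nonempty := by
    rw [hS']
    exact (((tendsto_cdf_atTop _).eventually_const_lt
      (by linarith [hπ.1] : 1 - π < 1)).mono fun _ h => le_of_lt h).exists
  have hbdd : BddBelow S := by
    obtain ⟨t, ht⟩ := ((tendsto_cdf_atBot (lawBU n a b)).eventually_lt_const
      (by linarith [hπ.2] : 0 < 1 - π)).exists
    refine ⟨t, fun s hs => ?_⟩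
    rw [hS'] at hs
    by_contra! hlt
    exact absurd (hs.trans (monotone_cdf _ hlt.le)) (not_le.mpr ht)
  rw [← cdf_eq_real]
  have hright : Filter.Tendsto (cdf (lawBU n a b)) (nhdsWithin (sInf S) (Set.Ioi (sInf S)))
      (nhds (cdf (lawBU n a b) (sInf S))) :=
    ((cdf (lawBU n a b)).right_continuous (sInf S)).mono_left
      (nhdsWithin_mono _ Set.Ioi_subset_Ici_self)
  refine ge_of_tendsto hright ?_
  filter_upwards [self_mem_nhdsWithin] with t ht
  obtain ⟨s, hs, hst⟩ := exists_lt_of_csInf_lt hne ht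
  rw [hS'] at hs
  exact le_trans hs (monotone_cdf _ hst.le)

theorem continuous_cdf (m : Measure ℝ) [IsProbabilityMeasure m] [NullSingletonClass m] :
    Continuous (cdf m) := by
  refine continuous_iff_continuousAt.mpr fun x => ?_
  rw [(monotone_cdf m).continuousAt_iff_leftLim_eq_rightLim, StieltjesFunction.rightLim_eq]
  have h := (cdf m).measure_singleton x
  rw [measure_cdf, measure_singleton, eq_comm, ENNReal.ofReal_eq_zero] at h
  exact le_antisymm ((monotone_cdf m).leftLim_le le_rfl) (by linarith)

theorem strictMono_cdf_of_isOpenPosMeasure (m : Measure ℝ) [IsProbabilityMeasure m]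
    [m.IsOpenPosMeasure] : StrictMono (cdf m) := by
  intro s t hst
  have h : 0 < m (Set.Ioc s t) :=
    (Measure.measure_Ioo_pos m |>.mpr hst).trans_le (measure_mono Set.Ioo_subset_Ioc_self)
  rw [← measure_cdf m, StieltjesFunction.measure_Ioc, ENNReal.ofReal_pos] at h
  linarith

/-- The probability integral transform. -/
theorem map_cdf_eq_uniform (m : Measure ℝ) [IsProbabilityMeasure m]
    (hc : Continuous (cdf m)) (hs : StrictMono (cdf m)) :
    m.map (cdf m) = volume.restrict (Set.Ioc (0:ℝ) 1) := by
  have : IsProbabilityMeasure (volume.restrict (Set.Ioc (0:ℝ) 1)) := ⟨by simp⟩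
  have : IsProbabilityMeasure (m.map (cdf m)) :=
    Measure.isProbabilityMeasure_map hc.measurable.aemeasurable
  have hpos : ∀ x, 0 < cdf m x := fun x => (cdf_nonneg m (x - 1)).trans_lt (hs (by linarith))
  have hlt : ∀ x, cdf m x < 1 := fun x => (hs (by linarith : x < x + 1)).trans_le (cdf_le_one m _)
  refine Measure.ext_of_Iic _ _ fun t => ?_
  rw [Measure.map_apply hc.measurable measurableSet_Iic,
    Measure.restrict_apply measurableSet_Iic, Set.inter_comm, Set.Ioc_inter_Iic]
  rcases le_or_gt t 0 with h0 | h0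
  · have h1 : cdf m ⁻¹' Set.Iic t = ∅ := by
      ext x; simpa using h0.trans_lt (hpos x)
    simp [h1, h0]
  rcases le_or_gt 1 t with h1 | h1
  · have h2 : cdf m ⁻¹' Set.Iic t = Set.univ := by
      ext x; simpa using (hlt x).le.trans h1
    simp [h2, h1]
  · obtain ⟨x, hx⟩ : t ∈ Set.range (cdf m) :=
      mem_range_of_exists_le_of_exists_ge hc
        (((tendsto_cdf_atBot m).eventually_lt_const h0).mono fun _ h => le_of_lt h).exists
        (((tendsto_cdf_atTop m).eventually_const_lt h1).mono fun _ h => le_of_lt h).exists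
    have h2 : cdf m ⁻¹' Set.Iic t = Set.Iic x := by
      ext y
      simp [← hx, hs.le_iff_le]
    rw [h2, ← ofReal_cdf, hx]
    simp [h1.le]

/-- The law of a latent mean: mass `γₖ` at `ϑₖ`. -/
def latentLaw {K : ℕ} (ϑ γ : Fin K → ℝ) : Measure ℝ :=
  ∑ k, ENNReal.ofReal (γ k) • Measure.dirac (ϑ k)

/-- The joint law of a latent mean and its noisy observation. -/
def latentObsLaw {K : ℕ} (ϑ γ : Fin K → ℝ) : Measure (ℝ × ℝ) :=
  ((latentLaw ϑ γ).prod (gaussianReal 0 1)).map fun p => (p.1, p.1 + p.2)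

theorem isProbabilityMeasure_latentLaw {K : ℕ} (ϑ : Fin K → ℝ) {γ : Fin K → ℝ}
    (hγ : ∀ k, 0 ≤ γ k) (hγ1 : ∑ k, γ k = 1) : IsProbabilityMeasure (latentLaw ϑ γ) := by
  constructor
  simp [latentLaw, ← ENNReal.ofReal_sum_of_nonneg fun k _ => hγ k, hγ1]

theorem isProbabilityMeasure_latentObsLaw {K : ℕ} (ϑ : Fin K → ℝ) {γ : Fin K → ℝ}
    (hγ : ∀ k, 0 ≤ γ k) (hγ1 : ∑ k, γ k = 1) : IsProbabilityMeasure (latentObsLaw ϑ γ) := by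
  have := isProbabilityMeasure_latentLaw ϑ hγ hγ1
  exact Measure.isProbabilityMeasure_map (by fun_prop)

theorem lintegral_latentObsLaw {K : ℕ} (ϑ γ : Fin K → ℝ) {f : ℝ × ℝ → ENNReal}
    (hf : Measurable f) :
    ∫⁻ p, f p ∂latentObsLaw ϑ γ =
      ∑ k, ENNReal.ofReal (γ k) * ∫⁻ x, f (ϑ k, x) ∂gaussianReal (ϑ k) 1 := by
  rw [latentObsLaw, lintegral_map hf (by fun_prop), lintegral_prod _ (by fun_prop), latentLaw,
    lintegral_finsetSum_measure]
  refine Finset.sum_congr rfl fun k _ => ?_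
  rw [lintegral_smul_measure, lintegral_dirac, smul_eq_mul]
  have h : gaussianReal (ϑ k) 1 = (gaussianReal 0 1).map (ϑ k + ·) := by
    rw [gaussianReal_map_const_add, zero_add]
  rw [h, lintegral_map (by fun_prop) (by fun_prop)]

theorem lintegral_latentObsLaw_eq_lintegral_sum {K : ℕ} (ϑ : Fin K → ℝ) {γ : Fin K → ℝ}
    (hγ : ∀ k, 0 ≤ γ k) {f : ℝ × ℝ → ENNReal} (hf : Measurable f) :
    ∫⁻ p, f p ∂latentObsLaw ϑ γ =
      ∫⁻ x, ∑ k, ENNReal.ofReal (γ k * stdNormPDF (x - ϑ k)) * f (ϑ k, x) := by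
  rw [lintegral_latentObsLaw ϑ γ hf, lintegral_finsetSum']
  · refine Finset.sum_congr rfl fun k _ => ?_
    rw [gaussianReal_of_var_ne_zero _ one_ne_zero,
      lintegral_withDensity_eq_lintegral_mul _ (measurable_gaussianPDF _ _) (by fun_prop),
      ← lintegral_const_mul _ (by fun_prop)]
    refine lintegral_congr fun x => ?_
    rw [ENNReal.ofReal_mul (hγ k), mul_assoc, Pi.mul_apply, gaussianPDF, stdNormPDF,
      gaussianPDFReal_sub, zero_add]
  · intro k _
    unfold stdNormPDF
    exact Measurable.aemeasurable (by fun_prop)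

theorem cdf_map_snd_latentObsLaw {K : ℕ} (ϑ : Fin K → ℝ) {γ : Fin K → ℝ}
    (hγ : ∀ k, 0 ≤ γ k) (hγ1 : ∑ k, γ k = 1) (x : ℝ) :
    cdf ((latentObsLaw ϑ γ).map Prod.snd) x = mixCDF ϑ γ x := by
  have := isProbabilityMeasure_latentObsLaw ϑ hγ hγ1
  have : IsProbabilityMeasure ((latentObsLaw ϑ γ).map Prod.snd) :=
    Measure.isProbabilityMeasure_map (by fun_prop)
  have hk : ∀ k, gaussianReal (ϑ k) 1 (Set.Iic x) = gaussianReal 0 1 (Set.Iic (x - ϑ k)) := by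
    intro k
    have h : gaussianReal (ϑ k) 1 = (gaussianReal 0 1).map (ϑ k + ·) := by
      rw [gaussianReal_map_const_add, zero_add]
    rw [h, Measure.map_apply (by fun_prop) measurableSet_Iic]
    congr 1
    ext y
    simp [le_sub_iff_add_le']
  rw [cdf_eq_real, Measure.real, ← lintegral_indicator_one measurableSet_Iic,
    lintegral_map (measurable_one.indicator measurableSet_Iic) measurable_snd,
    lintegral_latentObsLaw ϑ γ (f := fun p => (Set.Iic x).indicator 1 p.2)
      ((measurable_one.indicator measurableSet_Iic).comp measurable_snd),
    ENNReal.toReal_sum]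
  · simp_rw [lintegral_indicator_one measurableSet_Iic, hk, ENNReal.toReal_mul,
      ENNReal.toReal_ofReal (hγ _)]
    rfl
  · intro k _
    rw [lintegral_indicator_one measurableSet_Iic]
    finiteness

theorem continuous_stdNormCDF : Continuous stdNormCDF := by
  have := nullSingletonClass_gaussianReal (μ := 0) (v := 1) one_ne_zero
  convert continuous_cdf (gaussianReal 0 1) using 1
  ext x
  rw [cdf_eq_real]
  rfl

theorem strictMono_stdNormCDF : StrictMono stdNormCDF := by
  have := (gaussianReal_absolutelyContinuous' 0 (v := 1) one_ne_zero).isOpenPosMeasure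
  convert strictMono_cdf_of_isOpenPosMeasure (gaussianReal 0 1) using 1
  ext x
  rw [cdf_eq_real]
  rfl

theorem continuous_mixCDF {K : ℕ} (ϑ γ : Fin K → ℝ) : Continuous (mixCDF ϑ γ) := by
  have := continuous_stdNormCDF
  unfold mixCDF
  fun_prop

theorem exists_pos_of_sum_eq_one {K : ℕ} {γ : Fin K → ℝ} (hγ1 : ∑ k, γ k = 1) :
    ∃ k, 0 < γ k := by
  by_contra! h
  linarith [Finset.sum_nonpos fun k (_ : k ∈ Finset.univ) => h k]

theorem strictMono_mixCDF {K : ℕ} (ϑ : Fin K → ℝ) {γ : Fin K → ℝ}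
    (hγ : ∀ k, 0 ≤ γ k) (hγ1 : ∑ k, γ k = 1) : StrictMono (mixCDF ϑ γ) := by
  intro s t hst
  obtain ⟨k, hk⟩ := exists_pos_of_sum_eq_one hγ1
  have hlt : ∀ k, stdNormCDF (s - ϑ k) < stdNormCDF (t - ϑ k) := fun k =>
    strictMono_stdNormCDF (by linarith)
  exact Finset.sum_lt_sum (fun k _ => mul_le_mul_of_nonneg_left (hlt k).le (hγ k))
    ⟨k, Finset.mem_univ k, mul_lt_mul_of_pos_left (hlt k) hk⟩

theorem map_mixCDF_snd_latentObsLaw {K : ℕ} (ϑ : Fin K → ℝ) {γ : Fin K → ℝ}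
    (hγ : ∀ k, 0 ≤ γ k) (hγ1 : ∑ k, γ k = 1) :
    (latentObsLaw ϑ γ).map (fun p => mixCDF ϑ γ p.2) = volume.restrict (Set.Ioc (0:ℝ) 1) := by
  have := isProbabilityMeasure_latentObsLaw ϑ hγ hγ1
  have : IsProbabilityMeasure ((latentObsLaw ϑ γ).map Prod.snd) :=
    Measure.isProbabilityMeasure_map (by fun_prop)
  have hcdf : ⇑(cdf ((latentObsLaw ϑ γ).map Prod.snd)) = mixCDF ϑ γ :=
    funext (cdf_map_snd_latentObsLaw ϑ hγ hγ1)
  rw [← map_cdf_eq_uniform ((latentObsLaw ϑ γ).map Prod.snd)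
    (hcdf ▸ continuous_mixCDF ϑ γ) (hcdf ▸ strictMono_mixCDF ϑ hγ hγ1), hcdf,
    Measure.map_map (continuous_mixCDF ϑ γ).measurable measurable_snd]
  rfl

/-- The observation vectors whose plausibility region contains `γ`. -/
def plausibleObs {n K : ℕ} (a b : Fin n → ℝ) (ϑ γ : Fin K → ℝ) (q : ℝ) : Set (Fin n → ℝ) :=
  {x | Bfun a b (fun l => mixCDF ϑ γ (orderStat x l)) ≤ q}

theorem measurableSet_plausibleObs {n K : ℕ} (a b : Fin n → ℝ) (ϑ γ : Fin K → ℝ) (q : ℝ) :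
    MeasurableSet (plausibleObs a b ϑ γ q) := by
  refine measurableSet_le ((measurable_Bfun a b).comp (measurable_pi_lambda _ fun l => ?_))
    measurable_const
  exact (continuous_mixCDF ϑ γ).measurable.comp
    ((measurable_pi_apply l).comp (measurable_orderStat n))

theorem le_pi_latentObsLaw_plausibleObs {n K : ℕ} (a b : Fin n → ℝ) {π : ℝ}
    (hπ : π ∈ Set.Ioo (0:ℝ) 1) (ϑ : Fin K → ℝ) {γ : Fin K → ℝ}
    (hγ : ∀ k, 0 ≤ γ k) (hγ1 : ∑ k, γ k = 1) :
    1 - π ≤ (Measure.pi fun _ : Fin n => latentObsLaw ϑ γ).real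
      {y | (fun j => (y j).2) ∈ plausibleObs a b ϑ γ (quantileBU n a b π)} := by
  have := isProbabilityMeasure_latentObsLaw ϑ hγ hγ1
  have hm : Measurable fun p : ℝ × ℝ => mixCDF ϑ γ p.2 :=
    (continuous_mixCDF ϑ γ).measurable.comp measurable_snd
  have : IsProbabilityMeasure ((latentObsLaw ϑ γ).map fun p => mixCDF ϑ γ p.2) :=
    Measure.isProbabilityMeasure_map hm.aemeasurable
  have hB : Measurable fun u : Fin n → ℝ => Bfun a b (orderStat u) :=
    (measurable_Bfun a b).comp (measurable_orderStat n)
  have hm' : Measurable fun (y : Fin n → ℝ × ℝ) j => mixCDF ϑ γ (y j).2 :=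
    measurable_pi_lambda _ fun j => hm.comp (measurable_pi_apply j)
  refine (le_measure_Iic_quantileBU n a b hπ).trans_eq ?_
  rw [lawBU, ← map_mixCDF_snd_latentObsLaw ϑ hγ hγ1,
    ← Measure.pi_map_pi fun _ => hm.aemeasurable, Measure.map_map hB hm', Measure.real,
    Measure.map_apply (hB.comp hm') measurableSet_Iic, Measure.real]
  congr 2
  ext y
  simp only [Set.mem_preimage, Function.comp_apply, Set.mem_Iic, plausibleObs, Set.mem_ofPred_eq]
  rw [orderStat_comp_of_monotone (strictMono_mixCDF ϑ hγ hγ1).monotone fun j => (y j).2]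

/-- The pairs `(t, x)` for which `t` is not a support point or lies beyond an endpoint computed
from `x`. -/
def excludedPairs {K : ℕ} (ϑ γ : Fin K → ℝ) (α : ℝ) : Set (ℝ × ℝ) :=
  {p | (∃ ℓ, p.1 < ϑ ℓ ∧ ∑ k ∈ Finset.Iic ℓ, postW ϑ γ p.2 k ≤ α / 2) ∨
    (∃ r, ϑ r < p.1 ∧ ∑ k ∈ Finset.Ici r, postW ϑ γ p.2 k ≤ α / 2) ∨ p.1 ∉ Set.range ϑ}

theorem measurable_postW {K : ℕ} (ϑ γ : Fin K → ℝ) (j : Fin K) :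
    Measurable fun x => postW ϑ γ x j := by
  unfold postW stdNormPDF
  fun_prop

theorem measurableSet_excludedPairs {K : ℕ} (ϑ γ : Fin K → ℝ) (α : ℝ) :
    MeasurableSet (excludedPairs ϑ γ α) := by
  have h := measurable_postW ϑ γ
  have hsum : ∀ s : Finset (Fin K), Measurable fun p : ℝ × ℝ => ∑ k ∈ s, postW ϑ γ p.2 k :=
    fun s => Finset.measurable_fun_sum s fun k _ => (h k).comp measurable_snd
  have e : excludedPairs ϑ γ α =
      (⋃ ℓ, {p | p.1 < ϑ ℓ} ∩ {p | ∑ k ∈ Finset.Iic ℓ, postW ϑ γ p.2 k ≤ α / 2}) ∪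
      ((⋃ r, {p | ϑ r < p.1} ∩ {p | ∑ k ∈ Finset.Ici r, postW ϑ γ p.2 k ≤ α / 2}) ∪
        Prod.fst ⁻¹' (Set.range ϑ)ᶜ) := by
    ext p
    simp [excludedPairs]
  rw [e]
  refine .union (.iUnion fun ℓ => ?_) (.union (.iUnion fun r => ?_) ?_)
  · exact (measurableSet_lt measurable_fst measurable_const).inter
      (measurableSet_le (hsum _) measurable_const)
  · exact (measurableSet_lt measurable_const measurable_fst).inter
      (measurableSet_le (hsum _) measurable_const)
  · exact measurable_fst (Set.finite_range ϑ).measurableSet.compl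

theorem mem_Icc_of_notMem_excludedPairs {K : ℕ} [NeZero K] {ϑ γ : Fin K → ℝ} {α t x : ℝ}
    (hϑ : StrictMono ϑ) (h : (t, x) ∉ excludedPairs ϑ γ α) :
    t ∈ Set.Icc (lowerEP ϑ γ α x) (upperEP ϑ γ α x) := by
  simp only [excludedPairs, Set.mem_ofPred_eq, not_or, not_exists, not_and, not_not] at h
  obtain ⟨h1, h2, k, rfl⟩ := h
  constructor
  · unfold lowerEP
    dsimp only
    split_ifs with hL
    · have := Finset.max'_mem _ hL
      rw [Finset.mem_filter] at this
      by_contra! hlt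
      exact h1 _ hlt this.2
    · exact hϑ.monotone (Fin.zero_le k)
  · unfold upperEP
    dsimp only
    split_ifs with hR
    · have := Finset.min'_mem _ hR
      rw [Finset.mem_filter] at this
      by_contra! hlt
      exact h2 _ hlt this.2
    · exact hϑ.monotone (Fin.le_def.mpr (by have := k.2; simp only; omega))

theorem lowerEP_mem_range {K : ℕ} [NeZero K] (ϑ γ : Fin K → ℝ) (α x : ℝ) :
    lowerEP ϑ γ α x ∈ Set.range ϑ := by
  unfold lowerEP
  dsimp only
  split_ifs <;> exact Set.mem_range_self _

theorem upperEP_mem_range {K : ℕ} [NeZero K] (ϑ γ : Fin K → ℝ) (α x : ℝ) :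
    upperEP ϑ γ α x ∈ Set.range ϑ := by
  unfold upperEP
  dsimp only
  split_ifs <;> exact Set.mem_range_self _

theorem stdNormPDF_pos (t : ℝ) : 0 < stdNormPDF t := gaussianPDFReal_pos 0 1 t one_ne_zero

theorem sum_mul_stdNormPDF_pos {K : ℕ} (ϑ : Fin K → ℝ) {γ : Fin K → ℝ}
    (hγ : ∀ k, 0 ≤ γ k) (hγ1 : ∑ k, γ k = 1) (x : ℝ) :
    0 < ∑ k, γ k * stdNormPDF (x - ϑ k) := by
  obtain ⟨k, hk⟩ := exists_pos_of_sum_eq_one hγ1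
  exact Finset.sum_pos' (fun k _ => mul_nonneg (hγ k) (stdNormPDF_pos _).le)
    ⟨k, Finset.mem_univ k, mul_pos hk (stdNormPDF_pos _)⟩

open Classical in
theorem sum_postW_excludedPairs_le {K : ℕ} {ϑ γ : Fin K → ℝ} {α : ℝ} (hα : 0 ≤ α)
    (hϑ : StrictMono ϑ) (hγ : ∀ k, 0 ≤ γ k) (x : ℝ) :
    ∑ k with (ϑ k, x) ∈ excludedPairs ϑ γ α, postW ϑ γ x k ≤ α := by
  have hpos : ∀ k, 0 ≤ postW ϑ γ x k := fun k =>
    div_nonneg (mul_nonneg (hγ k) (stdNormPDF_pos _).le)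
      (Finset.sum_nonneg fun j _ => mul_nonneg (hγ j) (stdNormPDF_pos _).le)
  set L := Finset.univ.filter fun ℓ : Fin K => ∑ k ∈ Finset.Iic ℓ, postW ϑ γ x k ≤ α / 2 with hL
  set R := Finset.univ.filter fun r : Fin K => ∑ k ∈ Finset.Ici r, postW ϑ γ x k ≤ α / 2 with hR
  have hLsum : ∑ k with ∃ ℓ ∈ L, k < ℓ, postW ϑ γ x k ≤ α / 2 := by
    rcases L.eq_empty_or_nonempty with h | h
    · simp only [h, Finset.notMem_empty, false_and, exists_false, Finset.filter_false,
        Finset.sum_empty]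
      linarith
    · refine le_trans (Finset.sum_le_sum_of_subset_of_nonneg (t := Finset.Iic (L.max' h))
        (fun k hk => ?_) fun k _ _ => hpos k) (Finset.mem_filter.mp (L.max'_mem h)).2
      obtain ⟨ℓ, hℓ, hkℓ⟩ := (Finset.mem_filter.mp hk).2
      exact Finset.mem_Iic.mpr (hkℓ.le.trans (L.le_max' ℓ hℓ))
  have hRsum : ∑ k with ∃ r ∈ R, r < k, postW ϑ γ x k ≤ α / 2 := by
    rcases R.eq_empty_or_nonempty with h | h
    · simp only [h, Finset.notMem_empty, false_and, exists_false, Finset.filter_false,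
        Finset.sum_empty]
      linarith
    · refine le_trans (Finset.sum_le_sum_of_subset_of_nonneg (t := Finset.Ici (R.min' h))
        (fun k hk => ?_) fun k _ _ => hpos k) (Finset.mem_filter.mp (R.min'_mem h)).2
      obtain ⟨r, hr, hkr⟩ := (Finset.mem_filter.mp hk).2
      exact Finset.mem_Ici.mpr ((R.min'_le r hr).trans hkr.le)
  calc ∑ k with (ϑ k, x) ∈ excludedPairs ϑ γ α, postW ϑ γ x k
      ≤ ∑ k ∈ (Finset.univ.filter fun k => ∃ ℓ ∈ L, k < ℓ) ∪
          Finset.univ.filter fun k => ∃ r ∈ R, r < k, postW ϑ γ x k := by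
        refine Finset.sum_le_sum_of_subset_of_nonneg (fun k hk => ?_) fun k _ _ => hpos k
        have := (Finset.mem_filter.mp hk).2
        simp only [excludedPairs, Set.mem_ofPred_eq, hϑ.lt_iff_lt, Set.mem_range_self,
          not_true_eq_false, or_false] at this
        simp only [Finset.mem_union, Finset.mem_filter, Finset.mem_univ, true_and, hL, hR]
        exact this.imp (fun ⟨ℓ, h1, h2⟩ => ⟨ℓ, h2, h1⟩) fun ⟨r, h1, h2⟩ => ⟨r, h2, h1⟩
    _ ≤ (∑ k with ∃ ℓ ∈ L, k < ℓ, postW ϑ γ x k) + ∑ k with ∃ r ∈ R, r < k, postW ϑ γ x k := by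
        rw [← Finset.sum_union_inter]
        exact le_add_of_nonneg_right (Finset.sum_nonneg fun k _ => hpos k)
    _ ≤ α := by linarith

theorem latentObsLaw_excludedPairs_inter_le {K : ℕ} {ϑ γ : Fin K → ℝ} {α : ℝ} (hα : 0 ≤ α)
    (hϑ : StrictMono ϑ) (hγ : ∀ k, 0 ≤ γ k) (hγ1 : ∑ k, γ k = 1) {S : Set ℝ}
    (hS : MeasurableSet S) :
    latentObsLaw ϑ γ (Prod.snd ⁻¹' S ∩ excludedPairs ϑ γ α) ≤
      ENNReal.ofReal α * latentObsLaw ϑ γ (Prod.snd ⁻¹' S) := by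
  classical
  have hS' : MeasurableSet (Prod.snd ⁻¹' S : Set (ℝ × ℝ)) := measurable_snd hS
  have hE := hS'.inter (measurableSet_excludedPairs ϑ γ α)
  rw [← lintegral_indicator_one hE, ← lintegral_indicator_one hS',
    lintegral_latentObsLaw_eq_lintegral_sum ϑ hγ (measurable_one.indicator hE),
    lintegral_latentObsLaw_eq_lintegral_sum ϑ hγ (measurable_one.indicator hS'),
    ← lintegral_const_mul' _ _ ENNReal.ofReal_ne_top]
  refine lintegral_mono fun x => ?_
  by_cases hx : x ∈ S
  · have hw : ∀ k, 0 ≤ γ k * stdNormPDF (x - ϑ k) := fun k =>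
      mul_nonneg (hγ k) (stdNormPDF_pos _).le
    have h := sum_postW_excludedPairs_le hα hϑ hγ x
    simp only [postW] at h
    rw [← Finset.sum_div, div_le_iff₀ (sum_mul_stdNormPDF_pos ϑ hγ hγ1 x)] at h
    simp only [Set.indicator_apply, Set.mem_inter_iff, Set.mem_preimage, hx, true_and, if_true,
      Pi.one_apply, mul_ite, mul_one, mul_zero, ← Finset.sum_filter]
    rw [← ENNReal.ofReal_sum_of_nonneg fun k _ => hw k,
      ← ENNReal.ofReal_sum_of_nonneg fun k _ => hw k, ← ENNReal.ofReal_mul hα]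
    exact ENNReal.ofReal_le_ofReal h
  · simp [hx]

theorem pi_latentObsLaw_excludedPairs_inter_le {n K : ℕ} {ϑ γ : Fin K → ℝ} {α : ℝ} (hα : 0 ≤ α)
    (hϑ : StrictMono ϑ) (hγ : ∀ k, 0 ≤ γ k) (hγ1 : ∑ k, γ k = 1) {G : Set (Fin n → ℝ)}
    (hG : MeasurableSet G) (i : Fin n) :
    (Measure.pi fun _ : Fin n => latentObsLaw ϑ γ)
        ({y | (fun j => (y j).2) ∈ G} ∩ {y | y i ∈ excludedPairs ϑ γ α}) ≤
      ENNReal.ofReal α *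
        (Measure.pi fun _ : Fin n => latentObsLaw ϑ γ) {y | (fun j => (y j).2) ∈ G} := by
  have := isProbabilityMeasure_latentObsLaw ϑ hγ hγ1
  have hsnd : Measurable fun (y : Fin n → ℝ × ℝ) j => (y j).2 := by fun_prop
  have hA : MeasurableSet {y : Fin n → ℝ × ℝ | (fun j => (y j).2) ∈ G} := hsnd hG
  have hE : MeasurableSet {y : Fin n → ℝ × ℝ | y i ∈ excludedPairs ϑ γ α} :=
    measurable_pi_apply i (measurableSet_excludedPairs ϑ γ α)
  rw [← lintegral_indicator_one hA, ← lintegral_indicator_one (hA.inter hE),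
    ← lintegral_const_mul' _ _ ENNReal.ofReal_ne_top]
  refine lintegral_le_of_lmarginal_le {i} (measurable_one.indicator (hA.inter hE))
    ((measurable_one.indicator hA).const_mul _) ?_
  rw [lmarginal_singleton, lmarginal_singleton]
  intro y
  set S : Set ℝ := {x | Function.update (fun j => (y j).2) i x ∈ G} with hSdef
  have hS : MeasurableSet S := measurable_update _ hG
  have hupd : ∀ p, (fun j => (Function.update y i p j).2) =
      Function.update (fun j => (y j).2) i p.2 := fun p => by
    ext j
    rcases eq_or_ne j i with rfl | h <;> simp [*]
  have hS' : MeasurableSet (Prod.snd ⁻¹' S : Set (ℝ × ℝ)) := measurable_snd hS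
  have key := latentObsLaw_excludedPairs_inter_le hα hϑ hγ hγ1 hS
  rw [← lintegral_indicator_one hS',
    ← lintegral_indicator_one (hS'.inter (measurableSet_excludedPairs ϑ γ α)),
    ← lintegral_const_mul' _ _ ENNReal.ofReal_ne_top] at key
  have hpreA : Prod.snd ⁻¹' S =
      Function.update y i ⁻¹' {y : Fin n → ℝ × ℝ | (fun j => (y j).2) ∈ G} := by
    ext p
    simp only [hSdef, Set.mem_preimage, Set.mem_ofPred_eq, hupd]
  have hpreE : excludedPairs ϑ γ α =
      Function.update y i ⁻¹' {y : Fin n → ℝ × ℝ | y i ∈ excludedPairs ϑ γ α} := by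
    ext p
    simp
  rw [hpreA] at key
  nth_rewrite 1 [hpreE] at key
  exact key

theorem map_latent_noise_eq_pi_latentObsLaw {K : ℕ} (n : ℕ) (ϑ : Fin K → ℝ) {γ : Fin K → ℝ}
    (hγ : ∀ k, 0 ≤ γ k) (hγ1 : ∑ k, γ k = 1) :
    ((Measure.pi fun _ : Fin n => latentLaw ϑ γ).prod
        (Measure.pi fun _ : Fin n => gaussianReal 0 1)).map
      (fun p j => (p.1 j, p.1 j + p.2 j)) = Measure.pi fun _ : Fin n => latentObsLaw ϑ γ := by
  have := isProbabilityMeasure_latentLaw ϑ hγ hγ1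
  have := isProbabilityMeasure_latentObsLaw ϑ hγ hγ1
  have hσ : SigmaFinite (((latentLaw ϑ γ).prod (gaussianReal 0 1)).map
      fun p : ℝ × ℝ => (p.1, p.1 + p.2)) := by
    change SigmaFinite (latentObsLaw ϑ γ)
    infer_instance
  unfold latentObsLaw
  rw [← (measurePreserving_arrowProdEquivProdArrow ℝ ℝ (Fin n) (fun _ => latentLaw ϑ γ)
      fun _ => gaussianReal 0 1).map_eq, Measure.map_map (by fun_prop) (by fun_prop),
    ← Measure.pi_map_pi (hμ := fun _ => hσ) fun _ => Measurable.aemeasurable (by fun_prop)]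
  rfl

/-- Coverage Property: if `θ₁,…,θₙ` are i.i.d. with mass `γ*ₖ` at `ϑₖ` and
`Xᵢ = θᵢ + Zᵢ` with `Z` i.i.d. `N(0,1)` independent of `θ`, then the interval
`Cᵢ(1-π, 1-α)` built from the plausibility region `Γ_{1-π}` covers `θᵢ` with probability
at least `(1-π)(1-α)`. -/
theorem stmt4
    {Ω : Type*} [MeasurableSpace Ω] (P : Measure Ω) [IsProbabilityMeasure P]
    (n K : ℕ) (hn : 1 ≤ n) [NeZero K]
    (a b : Fin n → ℝ) (ha : ∀ i, 0 < a i) (hb : ∀ i, 0 < b i)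
    (π α : ℝ) (hπ : π ∈ Set.Ioo (0:ℝ) 1) (hα : α ∈ Set.Ioo (0:ℝ) 1)
    (ϑ : Fin K → ℝ) (hϑ : StrictMono ϑ)
    (γstar : Fin K → ℝ) (hγ : ∀ k, 0 ≤ γstar k) (hγ1 : ∑ k, γstar k = 1)
    (θ Z : Fin n → Ω → ℝ)
    (hjoint : Measure.map (fun ω => (fun i => θ i ω, fun i => Z i ω)) P
      = (Measure.pi fun _ : Fin n =>
            ∑ k, ENNReal.ofReal (γstar k) • Measure.dirac (ϑ k)).prod
          (Measure.pi fun _ : Fin n => gaussianReal 0 1))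
    (X : Fin n → Ω → ℝ) (hX : ∀ i ω, X i ω = θ i ω + Z i ω)
    (i : Fin n) :
    (1 - π) * (1 - α) ≤
      (P {ω | θ i ω ∈ Set.Icc
          (sInf ((fun γ => lowerEP ϑ γ α (X i ω)) ''
            GammaRegion a b ϑ (quantileBU n a b π) (fun j => X j ω)))
          (sSup ((fun γ => upperEP ϑ γ α (X i ω)) ''
            GammaRegion a b ϑ (quantileBU n a b π) (fun j => X j ω)))}).toReal := by
  have hprob := isProbabilityMeasure_latentLaw ϑ hγ hγ1
  have hprob' := isProbabilityMeasure_latentObsLaw ϑ hγ hγ1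
  change _ = (Measure.pi fun _ : Fin n => latentLaw ϑ γstar).prod _ at hjoint
  have hae : AEMeasurable (fun ω => (fun i => θ i ω, fun i => Z i ω)) P :=
    .of_map_ne_zero (by rw [hjoint]; exact IsProbabilityMeasure.ne_zero _)
  set A := {y : Fin n → ℝ × ℝ |
    (fun j => (y j).2) ∈ plausibleObs a b ϑ γstar (quantileBU n a b π)} with hA
  set E := {y : Fin n → ℝ × ℝ | y i ∈ excludedPairs ϑ γstar α} with hE
  set ρ := Measure.pi fun _ : Fin n => latentObsLaw ϑ γstar with hρ
  have hsnd : Measurable fun (y : Fin n → ℝ × ℝ) j => (y j).2 := by fun_prop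
  have hAm : MeasurableSet A := hsnd (measurableSet_plausibleObs a b ϑ γstar _)
  have hEm : MeasurableSet E :=
    measurable_pi_apply i (measurableSet_excludedPairs ϑ γstar α)
  have hpair : Measurable fun (p : (Fin n → ℝ) × (Fin n → ℝ)) j => (p.1 j, p.1 j + p.2 j) := by
    fun_prop
  have hlaw : P.map (fun ω j => (θ j ω, X j ω)) = ρ := by
    rw [hρ, ← map_latent_noise_eq_pi_latentObsLaw n ϑ hγ hγ1, ← hjoint,
      AEMeasurable.map_map_of_aemeasurable hpair.aemeasurable hae]
    congr 1
    ext ω j <;> simp [hX]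
  have haeX : AEMeasurable (fun ω j => (θ j ω, X j ω)) P :=
    .of_map_ne_zero (by rw [hlaw]; exact IsProbabilityMeasure.ne_zero _)
  have hbound : (1 - π) * (1 - α) ≤ ρ.real (A \ E) := by
    have h1 : 1 - π ≤ ρ.real A := le_pi_latentObsLaw_plausibleObs a b hπ ϑ hγ hγ1
    have h2 : ρ.real (A ∩ E) ≤ α * ρ.real A := by
      have h := ENNReal.toReal_mono (by finiteness)
        (pi_latentObsLaw_excludedPairs_inter_le hα.1.le hϑ hγ hγ1
          (measurableSet_plausibleObs a b ϑ γstar (quantileBU n a b π)) i)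
      rwa [ENNReal.toReal_mul, ENNReal.toReal_ofReal hα.1.le] at h
    have h3 := measureReal_inter_add_sdiff (μ := ρ) (s := A) hEm
    nlinarith [hα.2]
  refine hbound.trans ?_
  rw [← hlaw, Measure.real, Measure.map_apply_of_aemeasurable haeX (hAm.diff hEm)]
  refine ENNReal.toReal_mono (measure_ne_top _ _) (measure_mono fun ω hω => ?_)
  have hmem : γstar ∈ GammaRegion a b ϑ (quantileBU n a b π) (fun j => X j ω) :=
    ⟨hγ, hγ1, hω.1⟩
  have hIcc := mem_Icc_of_notMem_excludedPairs hϑ hω.2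
  have hfin := Set.finite_range ϑ
  constructor
  · refine (csInf_le (hfin.bddBelow.mono ?_) (Set.mem_image_of_mem _ hmem)).trans hIcc.1
    rintro _ ⟨γ, -, rfl⟩
    exact lowerEP_mem_range ϑ γ α _
  · refine hIcc.2.trans (le_csSup (hfin.bddAbove.mono ?_) (Set.mem_image_of_mem _ hmem))
    rintro _ ⟨γ, -, rfl⟩
    exact upperEP_mem_range ϑ γ α _
end
end

section
/- (Validity of conservative predictive random sets.) Let θ ∈ ℝ^n, let X_1,…,X_n be independent with X_i ~ N(θ_i, 1), and define the real random variable T = B(F_θ(X_(1)),…,F_θ(X_(n))), where F_θ(x) = (1/n)·Σ_{k=1}^n Φ(x−θ_k). Let 𝓑 be a real random variable, independent of (X_1,…,X_n), that is stochastically larger than T, i.e. P(𝓑 > t) ≥ P(T > t) for all t ∈ ℝ. Define the plausibility function pl(t) = P(𝓑 ≥ t). Then for every α ∈ (0,1), P( pl(T) ≤ α ) ≤ α; i.e., the plausibility of the true parameter is stochastically no smaller than Uniform(0,1), so inference based on the induced random set Θ(𝓑) = { θ' : B(F_{θ'}(X_(1)),…,F_{θ'}(X_(n))) ≤ 𝓑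 } is valid. -/
open MeasureTheory ProbabilityTheory

noncomputable section

/-- The equal-weight normal mixture cdf `F_θ(x) = (1/n) ∑ₖ Φ(x - θₖ)`. -/
def eqMixCDF {n : ℕ} (θ : Fin n → ℝ) (x : ℝ) : ℝ := (1 / n) * ∑ k, stdNormCDF (x - θ k)

open Filter Topology

/-- A stochastic order between upper tails passes from open to closed half-lines; no
measurability of the smaller function is required. -/
lemma measure_le_le_of_measure_lt_le {Ω : Type*} [MeasurableSpace Ω] {P : Measure Ω}
    [IsFiniteMeasure P] {B T : Ω → ℝ} (hB : Measurable B)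
    (h : ∀ t : ℝ, P {ω | t < T ω} ≤ P {ω | t < B ω}) (s : ℝ) :
    P {ω | s ≤ T ω} ≤ P {ω | s ≤ B ω} := by
  obtain ⟨u, hu, hus, hlim⟩ := exists_seq_strictMono_tendsto s
  have heq : ⋂ k, {ω | u k < B ω} = {ω | s ≤ B ω} := by
    ext ω
    simp only [Set.mem_iInter, Set.mem_ofPred_eq]
    exact ⟨fun hω => le_of_tendsto' hlim fun k => (hω k).le, fun hω k => (hus k).trans_le hω⟩
  have htend := tendsto_measure_iInter_atTop (μ := P) (s := fun k => {ω | u k < B ω})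
    (fun k => (measurableSet_lt measurable_const hB).nullMeasurableSet)
    (fun i j hij ω hω => (hu.monotone hij).trans_lt hω) ⟨0, measure_ne_top _ _⟩
  rw [heq] at htend
  exact ge_of_tendsto' htend fun k =>
    (measure_mono fun ω hω => (hus k).trans_le hω).trans (h (u k))

/-- A uniform bound on the closed upper tails beyond `s` bounds the open upper tail at `s`. -/
lemma measure_lt_le_of_forall_gt {Ω : Type*} [MeasurableSpace Ω] {P : Measure Ω}
    {B : Ω → ℝ} {s : ℝ} {c : ENNReal} (h : ∀ t, s < t → P {ω | t ≤ B ω} ≤ c) :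
    P {ω | s < B ω} ≤ c := by
  obtain ⟨u, hu, hsu, hlim⟩ := exists_seq_strictAnti_tendsto s
  have heq : ⋃ k, {ω | u k ≤ B ω} = {ω | s < B ω} := by
    ext ω
    simp only [Set.mem_iUnion, Set.mem_ofPred_eq]
    exact ⟨fun ⟨k, hk⟩ => (hsu k).trans_le hk,
      fun hω => ((hlim.eventually_lt_const hω).exists).imp fun k hk => hk.le⟩
  have htend := tendsto_measure_iUnion_atTop (μ := P) (s := fun k => {ω | u k ≤ B ω})
    (fun i j hij ω hω => (hu.antitone hij).trans hω)
  rw [heq] at htend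
  exact le_of_tendsto' htend fun k => h _ (hsu k)

/-- A uniform bound on all closed upper tails bounds the total mass. -/
lemma measure_univ_le_of_forall_measure_le {Ω : Type*} [MeasurableSpace Ω] {P : Measure Ω}
    {B : Ω → ℝ} {c : ENNReal} (h : ∀ t, P {ω | t ≤ B ω} ≤ c) : P Set.univ ≤ c := by
  have heq : ⋃ k : ℕ, {ω | -(k : ℝ) ≤ B ω} = Set.univ := by
    ext ω
    simp only [Set.mem_iUnion, Set.mem_ofPred_eq, Set.mem_univ, iff_true]
    exact (exists_nat_ge (-B ω)).imp fun k hk => by linarith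
  have htend := tendsto_measure_iUnion_atTop (μ := P) (s := fun k : ℕ => {ω | -(k : ℝ) ≤ B ω})
    (fun i j hij ω (hω : -(i : ℝ) ≤ B ω) =>
      show -(j : ℝ) ≤ B ω from (neg_le_neg (Nat.cast_le.2 hij)).trans hω)
  rw [heq] at htend
  exact le_of_tendsto' htend fun k => h _

/-- If `B` is stochastically larger than `T`, the upper-tail function of `B` evaluated at `T`
is stochastically no smaller than uniform. -/
lemma measure_tail_comp_le {Ω : Type*} [MeasurableSpace Ω] {P : Measure Ω}
    [IsProbabilityMeasure P] {B T : Ω → ℝ} (hB : Measurable B)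
    (h : ∀ t : ℝ, P {ω | t < T ω} ≤ P {ω | t < B ω}) {c : ENNReal} (hc : c < 1) :
    P {ω | P {ω' | T ω ≤ B ω'} ≤ c} ≤ c := by
  set S : Set ℝ := {t | P {ω | t ≤ B ω} ≤ c}
  have hup : ∀ {r t}, r ∈ S → r ≤ t → t ∈ S := fun hr hrt =>
    (measure_mono fun ω hω => hrt.trans hω).trans hr
  change P {ω | T ω ∈ S} ≤ c
  rcases S.eq_empty_or_nonempty with hemp | hne
  · simp [hemp]
  have hbdd : BddBelow S := by
    by_contra hb
    refine hc.not_ge ?_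
    rw [← measure_univ (μ := P)]
    refine measure_univ_le_of_forall_measure_le (B := B) fun t => ?_
    obtain ⟨r, hr, hrt⟩ := not_bddBelow_iff.1 hb t
    exact hup hr hrt.le
  by_cases hs : sInf S ∈ S
  · have hsub : {ω | T ω ∈ S} ⊆ {ω | sInf S ≤ T ω} := fun ω hω => csInf_le hbdd hω
    exact (measure_mono hsub).trans ((measure_le_le_of_measure_lt_le hB h _).trans hs)
  · have hsub : {ω | T ω ∈ S} ⊆ {ω | sInf S < T ω} := fun ω hω =>
      (csInf_le hbdd hω).lt_of_ne fun heq => hs (heq ▸ hω)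
    refine (measure_mono hsub).trans ((h _).trans (measure_lt_le_of_forall_gt fun t ht => ?_))
    obtain ⟨r, hr, hrt⟩ := exists_lt_of_csInf_lt hne ht
    exact hup hr hrt.le

/-- Validity of conservative predictive random sets: if
`T = B(F_θ(X₍₁₎),…,F_θ(X₍ₙ₎))` with `Xᵢ ~ N(θᵢ, 1)` independent, and `𝓑` is independent
of `X` and stochastically larger than `T`, then the plausibility `pl(t) = P(𝓑 ≥ t)` of
the true parameter satisfies `P(pl(T) ≤ α) ≤ α` for every `α ∈ (0,1)`. -/
theorem stmt6
    {Ω : Type*} [MeasurableSpace Ω] (P : Measure Ω) [IsProbabilityMeasure P]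
    (n : ℕ) (hn : 1 ≤ n) (θ : Fin n → ℝ)
    (a b : Fin n → ℝ) (ha : ∀ i, 0 < a i) (hb : ∀ i, 0 < b i)
    (X : Fin n → Ω → ℝ)
    (hX : Measure.map (fun ω i => X i ω) P = Measure.pi fun i => gaussianReal (θ i) 1)
    (B : Ω → ℝ) (hBmeas : Measurable B)
    (hindep : IndepFun B (fun ω i => X i ω) P)
    (T : Ω → ℝ)
    (hT : ∀ ω, T ω = Bfun a b (fun i => eqMixCDF θ (orderStat (fun j => X j ω) i)))
    (hstoch : ∀ t : ℝ, P {ω | t < T ω} ≤ P {ω | t < B ω})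
    (pl : ℝ → ℝ) (hpl : ∀ t, pl t = (P {ω | t ≤ B ω}).toReal) :
    ∀ α ∈ Set.Ioo (0:ℝ) 1, (P {ω | pl (T ω) ≤ α}).toReal ≤ α := by
  intro α hα
  have key := measure_tail_comp_le hBmeas hstoch (c := ENNReal.ofReal α)
    (ENNReal.ofReal_lt_one.2 hα.2)
  refine ENNReal.toReal_le_of_le_ofReal hα.1.le (le_of_eq_of_le (congrArg P ?_) key)
  ext ω
  simp only [Set.mem_ofPred_eq, hpl]
  exact (ENNReal.le_ofReal_iff_toReal_le (measure_ne_top _ _) hα.1.le).symm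
end
end
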